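/- For every integer n ≥ 1, the group of units of Π_n = Mon⟨a,b,c | (ab^i c)^n = 1 (i ≥ 1)⟩ is isomorphic, as a group, to the free product of countably infinitely many cyclic groups of order n, i.e. to the group presented by Gp⟨x_i (i ≥ 1) | x_i^n = 1 (i ≥ 1)⟩. -/

import Mathlib

open Computability

/-- The three-letter alphabet `A = {a, b, c}`. -/
inductive Letter : Type
  | a | b | c

/-- The word `a b^i c` as a list of letters. -/
def wdL (i : ℕ) : List Letter := [Letter.a] ++ List.replicate i Letter.b ++ [Letter.c]

/-- One-step rewriting relation of the system `T₂ = {((a bⁱ c)², ε) : i ≥ 1}`: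
`u →_{T₂} v` iff `u = x (a bⁱ c)² y` and `v = x y` for some words `x, y` and some `i ≥ 1`. -/
def Step (u v : List Letter) : Prop :=
  ∃ x y : List Letter, ∃ i : ℕ, 1 ≤ i ∧ u = x ++ (wdL i ++ wdL i) ++ y ∧ v = x ++ y

/-- The word `a b^i c` as an element of the free monoid on `A`. -/
def wd (i : ℕ) : FreeMonoid Letter := FreeMonoid.ofList (wdL i)

/-- The defining relations of `Π_n`: `(a bⁱ c)ⁿ = 1` for every `i ≥ 1`. -/
def PinRel (n : ℕ) (u v : FreeMonoid Letter) : Prop :=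
  ∃ i : ℕ, 1 ≤ i ∧ u = wd i ^ n ∧ v = 1

/-- The least congruence on `A*` identifying `(a bⁱ c)ⁿ` with the empty word for all `i ≥ 1`;
its quotient is the monoid `Π_n = Mon⟨a,b,c | (a bⁱ c)ⁿ = 1 (i ≥ 1)⟩`. -/
def PinCon (n : ℕ) : Con (FreeMonoid Letter) := conGen (PinRel n)

namespace PinAux

open Letter

abbrev G (n : ℕ) := PresentedGroup {r : FreeGroup ℕ | ∃ i : ℕ, r = FreeGroup.of i ^ n}

abbrev X (n : ℕ) := G n × List (Letter × G n)

def x (n : ℕ) (i : ℕ) : G n := PresentedGroup.of i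

lemma x_pow (n i : ℕ) : x n i ^ n = 1 := by
  have : PresentedGroup.mk {r : FreeGroup ℕ | ∃ i : ℕ, r = FreeGroup.of i ^ n}
      (FreeGroup.of i ^ n) = 1 :=
    PresentedGroup.one_of_mem ⟨i, rfl⟩
  rw [map_pow] at this
  exact this

open Classical in
noncomputable def pop (n : ℕ) : ℕ → List (Letter × G n) → Option (X n)
  | _, [] => none
  | k, (Letter.b, g) :: L => if g = 1 then pop n (k+1) L else none
  | k+1, (Letter.c, g) :: L => some (x n k * g, L)
  | 0, (Letter.c, _) :: _ => none
  | _, (Letter.a, _) :: _ => none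

open Classical in
noncomputable def act1 (n : ℕ) : Letter → X n → X n
  | Letter.b, (g, L) => (1, (b, g) :: L)
  | Letter.c, (g, L) => (1, (c, g) :: L)
  | Letter.a, (g, L) => if g = 1 then (pop n 0 L).getD (1, (a, g) :: L) else (1, (a, g) :: L)

noncomputable def actF (n : ℕ) : FreeMonoid Letter →* Function.End (X n) :=
  FreeMonoid.lift (M := Function.End (X n)) (act1 n)

lemma actF_of (n : ℕ) (l : Letter) (p : X n) : actF n (FreeMonoid.of l) p = act1 n l p :=
  congrFun (FreeMonoid.lift_eval_of (M := Function.End (X n)) (act1 n) l) p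

lemma wd_eq (i : ℕ) : wd i = FreeMonoid.of a * FreeMonoid.of b ^ i * FreeMonoid.of c := by
  apply FreeMonoid.toList.injective
  have : ∀ i, FreeMonoid.toList (FreeMonoid.of b ^ i) = List.replicate i b := by
    intro i
    induction i with
    | zero => rfl
    | succ k ih => rw [pow_succ', FreeMonoid.toList_mul, ih]; rfl
  simp [wd, wdL, FreeMonoid.toList_mul, this]

lemma act_b_pow (n i : ℕ) (g : G n) (L) :
    (actF n (FreeMonoid.of b ^ i)) (1, (c, g) :: L) =
      (1, List.replicate i (b, 1) ++ (c, g) :: L) := by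
  induction i with
  | zero => rw [pow_zero, map_one]; rfl
  | succ k ih =>
    rw [pow_succ', map_mul]
    change actF n (FreeMonoid.of b) (actF n (FreeMonoid.of b ^ k) _) = _
    rw [ih, actF_of]
    simp [act1, List.replicate_succ]

lemma pop_rep (n i k : ℕ) (g : G n) (L) :
    pop n k (List.replicate i (b, 1) ++ (c, g) :: L) = pop n (k+i) ((c, g) :: L) := by
  induction i generalizing k with
  | zero => simp
  | succ j ih =>
    simp only [List.replicate_succ, List.cons_append, pop, if_true]
    rw [ih, show k + 1 + j = k + (j + 1) by omega]
    rfl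

lemma act_wd (n i : ℕ) (p : X n) : actF n (wd (i+1)) p = (x n i * p.1, p.2) := by
  obtain ⟨g, L⟩ := p
  rw [wd_eq, map_mul, map_mul]
  change actF n (FreeMonoid.of a) (actF n (FreeMonoid.of b ^ (i+1))
    (actF n (FreeMonoid.of c) (g, L))) = _
  have : actF n (FreeMonoid.of c) (g, L) = (1, (c, g) :: L) := by rw [actF_of]; rfl
  rw [this, act_b_pow]
  rw [actF_of]
  simp only [act1, if_true]
  rw [pop_rep, Nat.zero_add]
  simp [pop]

lemma act_wd_pow (n i k : ℕ) (p : X n) :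
    actF n (wd (i+1) ^ k) p = (x n i ^ k * p.1, p.2) := by
  induction k with
  | zero => rw [pow_zero, map_one, pow_zero, one_mul]; rfl
  | succ k ih =>
    rw [pow_succ', map_mul]
    change actF n (wd (i+1)) (actF n (wd (i+1) ^ k) p) = _
    rw [ih, act_wd, pow_succ', mul_assoc]

noncomputable def act (n : ℕ) : (PinCon n).Quotient →* Function.End (X n) :=
  (PinCon n).lift (actF n) (by
    refine Con.conGen_le.2 ?_
    rintro u v ⟨i, hi, rfl, rfl⟩
    obtain ⟨j, rfl⟩ := Nat.exists_eq_add_of_le' hi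
    rw [Con.ker_rel, map_one]
    funext p
    rw [act_wd_pow, x_pow, one_mul]; rfl)

def q (n : ℕ) (l : Letter) : (PinCon n).Quotient := (PinCon n).mk' (FreeMonoid.of l)

lemma act_q (n : ℕ) (l) : act n (q n l) = act1 n l := by
  funext p
  exact actF_of n l p

lemma act_mul (n : ℕ) (u v) (p : X n) : act n (u * v) p = act n u (act n v p) := by
  rw [map_mul]; rfl

lemma act_one (n : ℕ) (p : X n) : act n 1 p = p := by
  rw [map_one]; rfl

def w (n i : ℕ) : (PinCon n).Quotient := (PinCon n).mk' (wd (i+1))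

lemma w_eq (n i : ℕ) : w n i = q n a * q n b ^ (i+1) * q n c := by
  simp only [w, q, wd_eq, map_mul, map_pow]

lemma w_pow (n i : ℕ) : w n i ^ n = 1 := by
  rw [w, ← map_pow, ← map_one (PinCon n).mk']
  exact (Con.eq _).2 (ConGen.Rel.of _ _ ⟨i+1, by omega, rfl, rfl⟩)

def wU (n : ℕ) (hn : 1 ≤ n) (i : ℕ) : ((PinCon n).Quotient)ˣ :=
  Units.ofPowEqOne (w n i) n (w_pow n i) (by omega)

def φ (n : ℕ) (hn : 1 ≤ n) : G n →* ((PinCon n).Quotient)ˣ :=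
  PresentedGroup.toGroup (f := wU n hn) (by
    rintro r ⟨i, rfl⟩
    rw [map_pow, FreeGroup.lift_apply_of]
    exact Units.pow_ofPowEqOne _ _)

lemma φ_x (n hn i) : ((φ n hn (x n i) : ((PinCon n).Quotient)ˣ) : (PinCon n).Quotient) = w n i := by
  simp only [φ, x, PresentedGroup.toGroup.of]; rfl

lemma act_φ (n hn) (g : G n) : ∀ p : X n, act n (φ n hn g) p = (g * p.1, p.2) := by
  have hinv : ∀ g : G n, (∀ p : X n, act n (φ n hn g) p = (g * p.1, p.2)) →
      ∀ p : X n, act n (φ n hn g⁻¹) p = (g⁻¹ * p.1, p.2) := by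
    intro g h p
    have h1 := h (g⁻¹ * p.1, p.2)
    simp only [mul_inv_cancel_left] at h1
    have h2 : act n (φ n hn g⁻¹) (act n (φ n hn g) (g⁻¹ * p.1, p.2)) = (g⁻¹ * p.1, p.2) := by
      rw [← act_mul, ← Units.val_mul, ← map_mul, inv_mul_cancel, map_one, Units.val_one, act_one]
    rw [h1] at h2
    exact h2
  obtain ⟨f, rfl⟩ := PresentedGroup.mk_surjective _ g
  have hx : ∀ i, ∀ p : X n, act n (φ n hn (x n i)) p = (x n i * p.1, p.2) := by
    intro i p
    rw [φ_x]
    exact act_wd n i p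
  induction f using FreeGroup.induction_on with
  | C1 => intro p; simp [act_one]
  | of i => exact hx i
  | inv_of i h => exact hinv (x n i) (hx i)
  | mul f g hf hg =>
    intro p
    rw [map_mul, map_mul, Units.val_mul, act_mul, hg, hf, mul_assoc]

lemma φ_inj (n hn) : Function.Injective (φ n hn) := by
  intro g h e
  have h1 := act_φ n hn g (1, [])
  rw [e, act_φ] at h1
  simpa using (congrArg Prod.fst h1).symm

def evL (n : ℕ) (hn : 1 ≤ n) : List (Letter × G n) → (PinCon n).Quotient
  | [] => 1
  | (s, g) :: L => q n s * φ n hn g * evL n hn L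

def ev (n : ℕ) (hn : 1 ≤ n) (p : X n) : (PinCon n).Quotient := φ n hn p.1 * evL n hn p.2

lemma pop_ev (n hn) : ∀ (L : List (Letter × G n)) (k : ℕ) (p : X n), pop n k L = some p →
    ev n hn p = q n a * q n b ^ k * evL n hn L
  | [], k, p, h => by simp [pop] at h
  | (Letter.a, g) :: L, k, p, h => by simp [pop] at h
  | (Letter.b, g) :: L, k, p, h => by
    rw [pop] at h
    split_ifs at h with hg
    rw [pop_ev n hn L _ _ h, hg, evL, pow_succ]
    simp [mul_assoc]
  | (Letter.c, g) :: L, 0, p, h => by simp [pop] at h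
  | (Letter.c, g) :: L, k+1, p, h => by
    rw [pop] at h
    obtain rfl := Option.some.inj h
    simp only [ev, evL, map_mul, Units.val_mul, φ_x, w_eq, mul_assoc]

lemma pop_a (n) : ∀ (L : List (Letter × G n)) (k : ℕ) (p : X n), pop n k L = some p →
    (∃ g, (a, g) ∈ L) → ∃ g, (a, g) ∈ p.2
  | [], k, p, h => by simp [pop] at h
  | (Letter.a, g) :: L, k, p, h => by simp [pop] at h
  | (Letter.b, g) :: L, k, p, h => by
    rw [pop] at h
    split_ifs at h with hg
    intro h'
    exact pop_a n L _ _ h (by simpa using h')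
  | (Letter.c, g) :: L, 0, p, h => by simp [pop] at h
  | (Letter.c, g) :: L, k+1, p, h => by
    rw [pop] at h
    obtain rfl := Option.some.inj h
    simp

lemma ev_act1 (n hn) (l) (p : X n) : ev n hn (act1 n l p) = q n l * ev n hn p := by
  obtain ⟨g, L⟩ := p
  cases l with
  | b => simp [act1, ev, evL, mul_assoc]
  | c => simp [act1, ev, evL, mul_assoc]
  | a =>
    have h0 : ev n hn (1, (a, g) :: L) = q n a * ev n hn (g, L) := by simp [ev, evL, mul_assoc]
    rw [act1]
    split_ifs with hg
    · cases h : pop n 0 L with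
      | none => exact h0
      | some p => simpa [ev, hg] using pop_ev n hn L _ _ h
    · exact h0

lemma a_act1 (n) (l) (p : X n) (h : ∃ g, (a, g) ∈ p.2) : ∃ g, (a, g) ∈ (act1 n l p).2 := by
  obtain ⟨g, L⟩ := p
  cases l with
  | b => simpa [act1] using h
  | c => simpa [act1] using h
  | a =>
    rw [act1]
    split_ifs with hg
    · cases h' : pop n 0 L with
      | none => exact ⟨g, by simp⟩
      | some p => exact pop_a n L _ _ h' h
    · exact ⟨g, by simp⟩

lemma q_ind (n) {P : (PinCon n).Quotient → Prop} (h1 : P 1)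
    (hm : ∀ l u, P u → P (q n l * u)) (u) : P u := by
  induction u using Con.induction_on with
  | H u =>
    induction u using FreeMonoid.inductionOn' with
    | one => exact h1
    | of_mul l u ih => exact hm l _ ih

lemma ev_act (n hn) (u) (p : X n) : ev n hn (act n u p) = u * ev n hn p := by
  induction u using q_ind with
  | h1 => simp [act_one]
  | hm l u ih => rw [act_mul, act_q, ev_act1, ih, mul_assoc]

lemma a_act (n) (u) (p : X n) (h : ∃ g, (a, g) ∈ p.2) : ∃ g, (a, g) ∈ (act n u p).2 := by
  induction u using q_ind with
  | h1 => simpa [act_one]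
  | hm l u ih => rw [act_mul, act_q]; exact a_act1 n l _ ih

lemma φ_surj (n hn) : Function.Surjective (φ n hn) := by
  intro u
  have hu : ev n hn (act n u (1, [])) = u := by rw [ev_act]; simp [ev, evL]
  have hback : act n (u⁻¹ : ((PinCon n).Quotient)ˣ) (act n u (1, [])) = (1, []) := by
    rw [← act_mul, Units.inv_mul, act_one]
  rcases hp : act n u (1, []) with ⟨g, L⟩
  rw [hp] at hu hback
  have key : ∀ (s : Letter) (h : G n) (L' : List (Letter × G n)), L = (s, h) :: L' →
      ∀ p, (act1 n s p).2 ≠ [] → 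
      p = act n (φ n hn h * evL n hn L' * (u⁻¹ * φ n hn g : ((PinCon n).Quotient)ˣ)) (1, []) →
      False := by
    rintro s h L' rfl p hne rfl
    apply hne
    rw [← act_q, ← act_mul]
    have : q n s * (φ n hn h * evL n hn L' * (u⁻¹ * φ n hn g : ((PinCon n).Quotient)ˣ)) = 1 := by
      have e : (φ n hn g : (PinCon n).Quotient) * (q n s * (φ n hn h * evL n hn L')) = u := by
        rw [← hu]; simp [ev, evL, mul_assoc]
      have e2 : q n s * (φ n hn h * evL n hn L') = ((φ n hn g)⁻¹ * u : ((PinCon n).Quotient)ˣ) := by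
        rw [Units.val_mul, ← e, Units.inv_mul_cancel_left]
      rw [← mul_assoc, e2, ← Units.val_mul]
      simp
    rw [this, act_one]
  cases L with
  | nil => exact ⟨g, Units.ext (by simpa [ev, evL] using hu)⟩
  | cons t L' =>
    obtain ⟨s, h⟩ := t
    exfalso
    cases s with
    | a =>
      have := a_act n (u⁻¹ : ((PinCon n).Quotient)ˣ) (g, (a, h) :: L') ⟨h, by simp⟩
      rw [hback] at this
      simp at this
    | b => exact key _ _ _ rfl _ (by simp [act1]) rfl
    | c => exact key _ _ _ rfl _ (by simp [act1]) rfl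

end PinAux

/-- For every `n ≥ 1`, the group of units of `Π_n` is isomorphic to the free product of
countably infinitely many cyclic groups of order `n`, i.e. to
`Gp⟨xᵢ (i ≥ 1) | xᵢⁿ = 1 (i ≥ 1)⟩`. -/
theorem units_Pin_iso_free_product_Cn (n : ℕ) (hn : 1 ≤ n) :
    Nonempty
      (((PinCon n).Quotientˣ) ≃*
        PresentedGroup {r : FreeGroup ℕ | ∃ i : ℕ, r = FreeGroup.of i ^ n}) := by
  exact ⟨(MulEquiv.ofBijective (PinAux.φ n hn) ⟨PinAux.φ_inj n hn, PinAux.φ_surj n hn⟩).symm⟩
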